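/- Let X be a real Banach space, f ∈ X, and let N : X → X be analytic at f with infinite radius of convergence. Assume ‖N^{(n)}(f)‖ ≤ M a^n n! for all n ∈ ℕ, where M, a > 0 satisfy Ma = 1/4. Then the sum u := ∑_{n=0}^{∞} u_n of the Adomian series satisfies ‖u‖ ≤ ‖f‖ + (1 + 8/√(3π))·M, and for every n ∈ ℕ* one has ‖u − ∑_{j=0}^{n} u_j‖ ≤ (8M/√(3π))·(1/√n). -/

import Mathlib

open scoped BigOperators

variable {X : Type*} [NormedAddCommGroup X] [NormedSpace ℝ X] [CompleteSpace X]

/-- The set of tuples `(j 0, …, j (n-1))` of nonnegative integers (representing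
`(j_1, …, j_n)`) with `j_1 + 2 j_2 + ⋯ + n j_n = n`. -/
def adomianTuples (n : ℕ) : Finset (Fin n → ℕ) :=
  (Fintype.piFinset fun _ : Fin n => Finset.range (n + 1)).filter
    fun j => ∑ i : Fin n, (i.1 + 1) * j i = n

/-- The list consisting of `j i` copies of `g i`, for `i = 0, …, n-1` in order. -/
def repList {X : Type*} {n : ℕ} (j : Fin n → ℕ) (g : Fin n → X) : List X :=
  (List.ofFn fun i => List.replicate (j i) (g i)).flatten

theorem repList_length {X : Type*} {n : ℕ} (j : Fin n → ℕ) (g : Fin n → X) :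
    (repList j g).length = ∑ i : Fin n, j i := by
  simp [repList, List.length_flatten, List.map_ofFn, Function.comp_def, List.sum_ofFn]

/-- The family of arguments `g 0, …, g 0, g 1, …, g 1, …` with `g i` repeated `j i` times,
indexed by `Fin (∑ i, j i)`: this realizes the application
`F.(x_1^{[j_1]} ⋯ x_n^{[j_n]})` of a (symmetric) multilinear map `F`. -/
def repArgs {X : Type*} {n : ℕ} (j : Fin n → ℕ) (g : Fin n → X) :
    Fin (∑ i : Fin n, j i) → X :=
  fun k => (repList j g).get (Fin.cast (repList_length j g).symm k)

/-- The `n`-th Adomian polynomial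
`A_n = ∑_{j_1+2j_2+⋯+nj_n=n} (1/(j_1!⋯j_n!)) N^{(j_1+⋯+j_n)}(f).(u_1^{[j_1]} ⋯ u_n^{[j_n]})`,
where `N^{(p)}(f)` is the `p`-th (iterated Fréchet) derivative of `N` at `f`. -/
noncomputable def adomianA (N : X → X) (f : X) (u : ℕ → X) (n : ℕ) : X :=
  ∑ j ∈ adomianTuples n,
    (∏ i : Fin n, ((j i).factorial : ℝ))⁻¹ •
      iteratedFDeriv ℝ (∑ i : Fin n, j i) N f (repArgs j fun i => u (i.1 + 1))

/-- `N` is analytic at `f` with infinite radius of convergence: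
`N x = N f + ∑_{p≥1} (1/p!) N^{(p)}(f).(x-f)^{[p]}` for every `x ∈ X`, the series converging
absolutely, where the coefficients `N^{(p)}(f)` are the iterated Fréchet derivatives of `N`
at `f` (the `p = 0` term of the `HasSum` below being exactly `N f`). -/
def HasEntireExpansionAt (N : X → X) (f : X) : Prop :=
  ∀ x : X,
    HasSum (fun p : ℕ => ((p.factorial : ℝ))⁻¹ •
      iteratedFDeriv ℝ p N f fun _ => x - f) (N x) ∧
    Summable fun p : ℕ => ((p.factorial : ℝ))⁻¹ * ‖iteratedFDeriv ℝ p N f fun _ => x - f‖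

theorem mem_adomianTuples {n : ℕ} {j : Fin n → ℕ} :
    j ∈ adomianTuples n ↔ ∑ i : Fin n, (i.1 + 1) * j i = n := by
  simp only [adomianTuples, Finset.mem_filter, Fintype.mem_piFinset, Finset.mem_range,
    and_iff_right_iff_imp]
  intro h i
  have := Finset.single_le_sum (f := fun i : Fin n => (i.1 + 1) * j i)
    (fun _ _ => Nat.zero_le _) (Finset.mem_univ i)
  nlinarith [Nat.zero_le (i.1 * j i)]

theorem sum_le_of_mem_adomianTuples {n : ℕ} {j : Fin n → ℕ} (hj : j ∈ adomianTuples n) :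
    ∑ i, j i ≤ n := by
  calc ∑ i, j i ≤ ∑ i : Fin n, (i.1 + 1) * j i :=
        Finset.sum_le_sum fun i _ => Nat.le_mul_of_pos_left _ (Nat.succ_pos _)
    _ = n := mem_adomianTuples.1 hj

open PowerSeries in
/-- The scalar Adomian sums are coefficients of a truncated geometric series. -/
theorem coeff_sum_pow_eq_sum_adomianTuples {R : Type*} [CommRing R] (c : ℕ → R) (n : ℕ) :
    coeff n (∑ p ∈ Finset.range (n + 1), (∑ i : Fin n, monomial (i.1 + 1) (c i)) ^ p) =
      ∑ j ∈ adomianTuples n, (Nat.multinomial Finset.univ j : R) * ∏ i : Fin n, c i ^ j i := by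
  have hmon (k : Fin n → ℕ) : ∏ i : Fin n, (monomial (i.1 + 1) (c i) : R⟦X⟧) ^ k i =
      monomial (∑ i : Fin n, (i.1 + 1) * k i) (∏ i : Fin n, c i ^ k i) := by
    simp_rw [monomial_pow, prod_monomial, mul_comm]
  rw [← Finset.sum_fiberwise_of_maps_to (s := adomianTuples n)
    (t := Finset.range (n + 1)) (g := fun j : Fin n → ℕ => ∑ i, j i)
    (fun j hj => Finset.mem_range_succ_iff.2 (sum_le_of_mem_adomianTuples hj)), map_sum]
  refine Finset.sum_congr rfl fun p _ => ?_
  have hT : (adomianTuples n).filter (fun j => ∑ i, j i = p) =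
      (Finset.piAntidiag Finset.univ p).filter
        fun j => n = ∑ i : Fin n, (i.1 + 1) * j i := by
    ext j
    simp [mem_adomianTuples, and_comm, eq_comm]
  rw [hT, Finset.sum_filter, Finset.sum_pow_eq_sum_piAntidiag, map_sum]
  refine Finset.sum_congr rfl fun k _ => ?_
  rw [hmon, ← map_natCast (C (R := R)), coeff_C_mul, coeff_monomial, mul_ite, mul_zero]

open PowerSeries in
theorem sum_adomianTuples_multinomial_mul_catalan (n : ℕ) :
    ∑ j ∈ adomianTuples n, (Nat.multinomial Finset.univ j : ℝ) *
      ∏ i : Fin n, (catalan i : ℝ) ^ j i = catalan n := by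
  rw [← coeff_sum_pow_eq_sum_adomianTuples (fun i => (catalan i : ℝ))]
  set B : ℝ⟦X⟧ := ∑ i : Fin n, monomial (i.1 + 1) (catalan i : ℝ) with hB
  set G : ℝ⟦X⟧ := catalanSeries.map (Nat.castRingHom ℝ) with hG
  have hGeq : G ^ 2 * X + 1 = G := by
    simpa using congrArg (PowerSeries.map (Nat.castRingHom ℝ)) catalanSeries_sq_mul_X_add_one
  have hdvd : (X : ℝ⟦X⟧) ^ (n + 1) ∣ X * G - B := by
    rw [X_pow_dvd_iff]
    intro m hm
    rcases m with _ | m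
    · rw [map_sub, coeff_zero_X_mul, hB, map_sum]
      simp only [coeff_monomial, (Nat.succ_ne_zero _).symm, if_false,
        Finset.sum_const_zero, sub_zero]
    · simp only [hB, hG, map_sub, coeff_succ_X_mul, map_sum, coeff_monomial, coeff_map,
        catalanSeries_coeff, add_left_inj]
      rw [Finset.sum_eq_single (⟨m, by omega⟩ : Fin n)]
      · simp
      · intro b _ hb
        exact if_neg fun h => hb (Fin.ext h.symm)
      · simp
  have hsum : (X : ℝ⟦X⟧) ^ (n + 1) ∣ G - ∑ p ∈ Finset.range (n + 1), B ^ p := by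
    have h1 : G - ∑ p ∈ Finset.range (n + 1), (X * G) ^ p = G * (X * G) ^ (n + 1) := by
      have h2 := geom_sum_mul_neg (X * G) (n + 1)
      have h3 : G * (1 - X * G) = 1 := by linear_combination -hGeq
      linear_combination (-G) * h2 + (∑ p ∈ Finset.range (n + 1), (X * G) ^ p) * h3
    have h4 : G - ∑ p ∈ Finset.range (n + 1), B ^ p = G * (X * G) ^ (n + 1) +
        ∑ p ∈ Finset.range (n + 1), ((X * G) ^ p - B ^ p) := by
      rw [Finset.sum_sub_distrib, ← h1]; ring
    rw [h4]
    refine dvd_add ?_ (Finset.dvd_sum fun p _ => hdvd.trans (sub_dvd_pow_sub_pow _ _ p))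
    rw [mul_pow]
    exact Dvd.intro_left (G * G ^ (n + 1)) (by ring)
  have := X_pow_dvd_iff.1 hsum n (Nat.lt_succ_self n)
  rw [map_sub, sub_eq_zero] at this
  rw [← this, hG, coeff_map, catalanSeries_coeff]
  simp

theorem prod_norm_repArgs {X : Type*} [NormedAddCommGroup X] {n : ℕ} (j : Fin n → ℕ)
    (g : Fin n → X) : ∏ k, ‖repArgs j g k‖ = ∏ i, ‖g i‖ ^ j i := by
  have h : ∏ k, ‖repArgs j g k‖ = ((repList j g).map norm).prod := by
    rw [← Fintype.prod_equiv (finCongr (repList_length j g))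
      (fun k => ‖(repList j g).get k‖) _ fun k => by simp [repArgs], ← List.prod_ofFn]
    congr 1
    simp [List.ofFn_getElem_eq_map]
  rw [h, repList, List.map_flatten, List.prod_flatten]
  simp [List.map_ofFn, Function.comp_def, List.prod_ofFn]

theorem norm_adomianA_le {X : Type*} [NormedAddCommGroup X] [NormedSpace ℝ X]
    {N : X → X} {f : X} {M a : ℝ}
    (hderiv : ∀ n : ℕ, ‖iteratedFDeriv ℝ n N f‖ ≤ M * a ^ n * n.factorial)
    (u : ℕ → X) (n : ℕ) :
    ‖adomianA N f u n‖ ≤ M * ∑ j ∈ adomianTuples n, (Nat.multinomial Finset.univ j : ℝ) *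
      ∏ i : Fin n, (a * ‖u (i.1 + 1)‖) ^ j i := by
  rw [adomianA, Finset.mul_sum]
  refine norm_sum_le_of_le _ fun j _ => ?_
  have hP : 0 < ∏ i : Fin n, ((j i).factorial : ℝ) :=
    Finset.prod_pos fun i _ => by positivity
  have hmult : (∏ i : Fin n, ((j i).factorial : ℝ)) * Nat.multinomial Finset.univ j =
      (∑ i, j i).factorial := by
    exact_mod_cast Nat.multinomial_spec Finset.univ j
  rw [norm_smul, norm_inv, Real.norm_of_nonneg hP.le, inv_mul_le_iff₀ hP]
  refine (ContinuousMultilinearMap.le_opNorm _ _).trans ?_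
  rw [prod_norm_repArgs]
  refine (mul_le_mul_of_nonneg_right (hderiv _) (by positivity)).trans_eq ?_
  simp_rw [mul_pow, Finset.prod_mul_distrib, Finset.prod_pow_eq_pow_sum, ← hmult]
  ring

theorem norm_adomian_succ_le {X : Type*} [NormedAddCommGroup X] [NormedSpace ℝ X]
    {N : X → X} {f : X} {M a : ℝ} (hM : 0 < M) (ha : 0 < a) (hMa : M * a = 1 / 4)
    (hderiv : ∀ n : ℕ, ‖iteratedFDeriv ℝ n N f‖ ≤ M * a ^ n * n.factorial)
    {u : ℕ → X} (hu : ∀ n : ℕ, u (n + 1) = adomianA N f u n) (n : ℕ) :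
    ‖u (n + 1)‖ ≤ M * (catalan n / 4 ^ n) := by
  induction n using Nat.strong_induction_on with
  | _ n ih =>
    rw [hu, ← sum_adomianTuples_multinomial_mul_catalan, Finset.sum_div]
    refine (norm_adomianA_le hderiv u n).trans ?_
    gcongr with j hj
    rw [mul_div_assoc]
    gcongr
    have h4 : (4 : ℝ) ^ n = ∏ i : Fin n, ((4 : ℝ) ^ (i.1 + 1)) ^ j i := by
      simp_rw [← pow_mul, Finset.prod_pow_eq_pow_sum, mem_adomianTuples.1 hj]
    rw [h4, ← Finset.prod_div_distrib]
    refine Finset.prod_le_prod (fun i _ => by positivity) fun i _ => ?_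
    rw [← div_pow]
    gcongr
    calc a * ‖u (i.1 + 1)‖ ≤ a * (M * (catalan i / 4 ^ i.1)) := by
          gcongr
          exact ih i i.2
      _ = (M * a) * (catalan i / 4 ^ i.1) := by ring
      _ = catalan i / 4 ^ (i.1 + 1) := by rw [hMa, pow_succ]; field_simp

theorem catalan_div_four_pow (k : ℕ) :
    (catalan k : ℝ) / 4 ^ k =
      2 * (k.centralBinom / 4 ^ k) - 2 * ((k + 1).centralBinom / 4 ^ (k + 1)) := by
  have h1 : ((k : ℝ) + 1) * catalan k = k.centralBinom := by
    exact_mod_cast succ_mul_catalan_eq_centralBinom k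
  have h2 : ((k : ℝ) + 1) * (k + 1).centralBinom = 2 * (2 * k + 1) * k.centralBinom := by
    exact_mod_cast Nat.succ_mul_centralBinom_succ k
  have hk : (k : ℝ) + 1 ≠ 0 := by positivity
  rw [pow_succ]
  field_simp
  apply mul_left_cancel₀ hk
  linear_combination 4 * h1 + 2 * h2

theorem centralBinom_div_four_pow_sq_le (n : ℕ) :
    ((n.centralBinom : ℝ) / 4 ^ n) ^ 2 * (2 * n + 1) ≤ 1 := by
  induction n with
  | zero => simp
  | succ k ih =>
    have h2 : ((k : ℝ) + 1) * (k + 1).centralBinom = 2 * (2 * k + 1) * k.centralBinom := by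
      exact_mod_cast Nat.succ_mul_centralBinom_succ k
    have hk : (0 : ℝ) < k + 1 := by positivity
    have h3 : ((k + 1).centralBinom : ℝ) / 4 ^ (k + 1) =
        (k.centralBinom / 4 ^ k) * ((2 * k + 1) / (2 * (k + 1))) := by
      rw [pow_succ]
      field_simp
      linear_combination 2 * h2
    rw [h3]
    push_cast
    refine le_trans ?_ ih
    rw [mul_pow, mul_assoc]
    gcongr
    rw [div_pow, div_mul_eq_mul_div, div_le_iff₀ (by positivity)]
    nlinarith [(Nat.cast_nonneg k : (0 : ℝ) ≤ k)]

theorem centralBinom_div_four_pow_le {n : ℕ} (hn : 1 ≤ n) :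
    (n.centralBinom : ℝ) / 4 ^ n ≤ 1 / Real.sqrt (2 * n) := by
  have hn' : (0 : ℝ) < n := by exact_mod_cast hn
  rw [le_div_iff₀ (by positivity)]
  refine abs_le_of_sq_le_sq' ?_ zero_le_one |>.2
  rw [mul_pow, Real.sq_sqrt (by positivity), one_pow]
  exact le_trans (by gcongr; linarith) (centralBinom_div_four_pow_sq_le n)

theorem tendsto_centralBinom_div_four_pow :
    Filter.Tendsto (fun n : ℕ => (n.centralBinom : ℝ) / 4 ^ n) Filter.atTop (nhds 0) := by
  refine squeeze_zero' (Filter.Eventually.of_forall fun n => by positivity)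
    ((Filter.eventually_ge_atTop 1).mono fun n hn => centralBinom_div_four_pow_le hn) ?_
  refine tendsto_const_nhds.div_atTop (Real.tendsto_sqrt_atTop.comp ?_)
  exact tendsto_natCast_atTop_atTop.const_mul_atTop two_pos

theorem hasSum_catalan_div_four_pow (n : ℕ) :
    HasSum (fun k : ℕ => (catalan (k + n) : ℝ) / 4 ^ (k + n))
      (2 * (n.centralBinom / 4 ^ n)) := by
  rw [hasSum_iff_tendsto_nat_of_nonneg fun k => by positivity]
  have h (m : ℕ) : ∑ k ∈ Finset.range m, (catalan (k + n) : ℝ) / 4 ^ (k + n) =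
      2 * (n.centralBinom / 4 ^ n) - 2 * ((m + n).centralBinom / 4 ^ (m + n)) := by
    induction m with
    | zero => simp
    | succ m ih =>
      rw [Finset.sum_range_succ, ih, catalan_div_four_pow, Nat.add_right_comm m 1 n]
      ring
  simp_rw [h]
  simpa using (((tendsto_centralBinom_div_four_pow.comp
    (Filter.tendsto_add_atTop_nat n)).const_mul 2).const_sub
      (2 * ((n.centralBinom : ℝ) / 4 ^ n)))

theorem sqrt_three_mul_pi_le : Real.sqrt (3 * Real.pi) ≤ 4 * Real.sqrt 2 := by
  rw [Real.sqrt_le_left (by positivity), mul_pow, Real.sq_sqrt zero_le_two]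
  linarith [Real.pi_lt_four]

/-- Under the hypotheses `‖N^{(n)}(f)‖ ≤ M a^n n!` with `M, a > 0` and
`M a = 1/4`, the sum `u = ∑_{n=0}^∞ u_n` of the Adomian series satisfies
`‖u‖ ≤ ‖f‖ + (1 + 8/√(3π)) M` and `‖u - ∑_{j=0}^n u_j‖ ≤ (8M/√(3π)) (1/√n)` for `n ≥ 1`. -/
theorem adomian_estimates_critical_case
    (N : X → X) (f : X) (M a : ℝ) (hM : 0 < M) (ha : 0 < a) (hMa : M * a = 1 / 4)
    (hN : HasEntireExpansionAt N f)
    (hderiv : ∀ n : ℕ, ‖iteratedFDeriv ℝ n N f‖ ≤ M * a ^ n * n.factorial)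
    (u : ℕ → X) (hu0 : u 0 = f) (hu : ∀ n : ℕ, u (n + 1) = adomianA N f u n) :
    ‖∑' n : ℕ, u n‖ ≤ ‖f‖ + (1 + 8 / Real.sqrt (3 * Real.pi)) * M ∧
      ∀ n : ℕ, 1 ≤ n →
        ‖(∑' k : ℕ, u k) - ∑ j ∈ Finset.range (n + 1), u j‖ ≤
          8 * M / Real.sqrt (3 * Real.pi) * (1 / Real.sqrt n) := by
  have hle := norm_adomian_succ_le hM ha hMa hderiv hu
  have hpi : 0 < Real.sqrt (3 * Real.pi) := Real.sqrt_pos.2 (by positivity)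
  have hmaj (n : ℕ) := (hasSum_catalan_div_four_pow n).mul_left M
  have hsum : Summable u :=
    (summable_nat_add_iff 1).1 (Summable.of_norm_bounded (hmaj 0).summable hle)
  have htail (n : ℕ) : ‖(∑' k : ℕ, u k) - ∑ j ∈ Finset.range (n + 1), u j‖ ≤
      M * (2 * (n.centralBinom / 4 ^ n)) := by
    rw [← hsum.sum_add_tsum_nat_add (n + 1), add_sub_cancel_left]
    exact tsum_of_norm_bounded (hmaj n) fun k => hle (k + n)
  refine ⟨?_, fun n hn => ?_⟩
  · have h0 := htail 0
    simp only [zero_add, Finset.sum_range_one, Nat.centralBinom_zero, hu0] at h0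
    have h1 : 1 ≤ 8 / Real.sqrt (3 * Real.pi) := by
      rw [one_le_div hpi, Real.sqrt_le_left (by norm_num)]
      linarith [Real.pi_lt_four]
    have h2 : ‖∑' n : ℕ, u n‖ ≤ ‖f‖ + ‖(∑' n : ℕ, u n) - f‖ := norm_le_insert' _ _
    norm_num at h0
    nlinarith
  · have hn' : (0 : ℝ) < n := by exact_mod_cast hn
    calc _ ≤ M * (2 * (n.centralBinom / 4 ^ n)) := htail n
      _ ≤ M * (2 * (1 / Real.sqrt (2 * n))) := by
        gcongr M * (2 * ?_)
        exact centralBinom_div_four_pow_le hn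
      _ = M * (2 / Real.sqrt 2) * (1 / Real.sqrt n) := by
        rw [Real.sqrt_mul zero_le_two]; field_simp
      _ ≤ M * (8 / Real.sqrt (3 * Real.pi)) * (1 / Real.sqrt n) := by
        gcongr M * ?_ * _
        rw [div_le_div_iff₀ (by positivity) hpi]
        linarith [sqrt_three_mul_pi_le]
      _ = _ := by ring
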